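/- Let X ⊆ ℂⁿ be open and let Ω ⊆ X be open with closure cl Ω (taken in X) properly contained in X. Assume: (i) every d-closed smooth (1,1)-form on X with support contained in cl Ω equals dh for some smooth 1-form h on X with support contained in cl Ω; (ii) every ∂̄-closed smooth (0,1)-form on X with support contained in cl Ω equals ∂̄w for some smooth function w on X with support contained in cl Ω; (iii) every ∂-closed smooth (1,0)-form on X with support contained in cl Ω equals ∂w for some smooth function w on X with support contained in cl Ω. Then every d-closed smooth (1,1)-form g on X with support contained in cl Ω can be written g = ∂∂̄v, i.e. g_{jk} = ∂²v/∂z_j∂z̄_k for all j,k, for some smooth function v on X with support contained in cl Ω. -/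

import Mathlib

open Complex

noncomputable section

/-- Wirtinger derivative `∂u/∂z_j` of `u` within the set `X`, at `z`. -/
def wdz {n : ℕ} (X : Set (Fin n → ℂ)) (u : (Fin n → ℂ) → ℂ) (j : Fin n)
    (z : Fin n → ℂ) : ℂ :=
  (1 / 2 : ℂ) * (fderivWithin ℝ u X z (Pi.single j 1) -
    Complex.I * fderivWithin ℝ u X z (Pi.single j Complex.I))

/-- Wirtinger derivative `∂u/∂z̄_j` of `u` within the set `X`, at `z`. -/
def wdzbar {n : ℕ} (X : Set (Fin n → ℂ)) (u : (Fin n → ℂ) → ℂ) (j : Fin n)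
    (z : Fin n → ℂ) : ℂ :=
  (1 / 2 : ℂ) * (fderivWithin ℝ u X z (Pi.single j 1) +
    Complex.I * fderivWithin ℝ u X z (Pi.single j Complex.I))

/-- `∂²u/∂z_j∂z̄_k` within `X`. -/
def ddbar {n : ℕ} (X : Set (Fin n → ℂ)) (u : (Fin n → ℂ) → ℂ) (j k : Fin n)
    (z : Fin n → ℂ) : ℂ :=
  wdz X (wdzbar X u k) j z

/-- The support of `u` as a function on `X`: the closure in `X` of its nonvanishing set. -/
def suppIn {n : ℕ} (X : Set (Fin n → ℂ)) (u : (Fin n → ℂ) → ℂ) : Set (Fin n → ℂ) :=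
  X ∩ closure {z | z ∈ X ∧ u z ≠ 0}

/-- Support of a (1,1)-form given by its coefficient matrix. -/
def supp11 {n : ℕ} (X : Set (Fin n → ℂ)) (T : Fin n → Fin n → (Fin n → ℂ) → ℂ) :
    Set (Fin n → ℂ) :=
  ⋃ j, ⋃ k, suppIn X (T j k)

/-- Support of a 1-form `Σ a_j dz_j + Σ b_k dz̄_k`. -/
def supp1 {n : ℕ} (X : Set (Fin n → ℂ)) (a b : Fin n → (Fin n → ℂ) → ℂ) :
    Set (Fin n → ℂ) :=
  (⋃ j, suppIn X (a j)) ∪ (⋃ k, suppIn X (b k))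

/-- Smoothness of the coefficients of a (1,1)-form on `X`. -/
def Smooth11 {n : ℕ} (X : Set (Fin n → ℂ)) (f : Fin n → Fin n → (Fin n → ℂ) → ℂ) : Prop :=
  ∀ j k, ContDiffOn ℝ (⊤ : ℕ∞) (f j k) X

/-- A (1,1)-form `Σ f_{jk} dz_j ∧ dz̄_k` is d-closed. -/
def DClosed11 {n : ℕ} (X : Set (Fin n → ℂ)) (f : Fin n → Fin n → (Fin n → ℂ) → ℂ) : Prop :=
  ∀ j k l, ∀ z ∈ X,
    wdz X (f j k) l z = wdz X (f l k) j z ∧ wdzbar X (f j k) l z = wdzbar X (f j l) k z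

/-- `d(Σ a_j dz_j + Σ b_k dz̄_k) = f` for a (1,1)-form `f`. -/
def IsDOf {n : ℕ} (X : Set (Fin n → ℂ)) (a b : Fin n → (Fin n → ℂ) → ℂ)
    (f : Fin n → Fin n → (Fin n → ℂ) → ℂ) : Prop :=
  (∀ j k, ∀ z ∈ X, f j k z = wdz X (b k) j z - wdzbar X (a j) k z) ∧
  (∀ j l, ∀ z ∈ X, wdz X (a j) l z = wdz X (a l) j z) ∧
  (∀ k l, ∀ z ∈ X, wdzbar X (b k) l z = wdzbar X (b l) k z)

/-- A (0,1)-form `Σ b_k dz̄_k` is ∂̄-closed. -/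
def DbarClosed01 {n : ℕ} (X : Set (Fin n → ℂ)) (b : Fin n → (Fin n → ℂ) → ℂ) : Prop :=
  ∀ k l, ∀ z ∈ X, wdzbar X (b k) l z = wdzbar X (b l) k z

/-- A (1,0)-form `Σ a_j dz_j` is ∂-closed. -/
def DClosed10 {n : ℕ} (X : Set (Fin n → ℂ)) (a : Fin n → (Fin n → ℂ) → ℂ) : Prop :=
  ∀ j l, ∀ z ∈ X, wdz X (a j) l z = wdz X (a l) j z

section Wirtinger

variable {n : ℕ} {X : Set (Fin n → ℂ)} {u v : (Fin n → ℂ) → ℂ} {z : Fin n → ℂ}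

theorem wdz_congr (h : Set.EqOn u v X) (hz : z ∈ X) (j : Fin n) :
    wdz X u j z = wdz X v j z := by
  simp only [wdz, fderivWithin_congr h (h hz)]

theorem wdzbar_congr (h : Set.EqOn u v X) (hz : z ∈ X) (j : Fin n) :
    wdzbar X u j z = wdzbar X v j z := by
  simp only [wdzbar, fderivWithin_congr h (h hz)]

theorem wdz_sub (hX : IsOpen X) (hz : z ∈ X) (hu : DifferentiableWithinAt ℝ u X z)
    (hv : DifferentiableWithinAt ℝ v X z) (j : Fin n) :
    wdz X (fun y => u y - v y) j z = wdz X u j z - wdz X v j z := by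
  simp only [wdz, fderivWithin_fun_sub (hX.uniqueDiffWithinAt hz) hu hv,
    sub_apply]
  ring

theorem wdzbar_sub (hX : IsOpen X) (hz : z ∈ X) (hu : DifferentiableWithinAt ℝ u X z)
    (hv : DifferentiableWithinAt ℝ v X z) (j : Fin n) :
    wdzbar X (fun y => u y - v y) j z = wdzbar X u j z - wdzbar X v j z := by
  simp only [wdzbar, fderivWithin_fun_sub (hX.uniqueDiffWithinAt hz) hu hv,
    sub_apply]
  ring

theorem differentiableOn_fderivWithin (hX : IsOpen X) (hu : ContDiffOn ℝ (⊤ : ℕ∞) u X) :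
    DifferentiableOn ℝ (fderivWithin ℝ u X) X :=
  (hu.fderivWithin (m := 1) hX.uniqueDiffOn
    (WithTop.coe_le_coe.2 (le_top : (1 + 1 : ℕ∞) ≤ ⊤))).differentiableOn
    one_ne_zero

theorem differentiableOn_wdzbar (hX : IsOpen X) (hu : ContDiffOn ℝ (⊤ : ℕ∞) u X) (j : Fin n) :
    DifferentiableOn ℝ (wdzbar X u j) X := by
  have h := differentiableOn_fderivWithin hX hu
  unfold wdzbar
  fun_prop

theorem fderivWithin_wdz (hX : IsOpen X) (hu : ContDiffOn ℝ (⊤ : ℕ∞) u X) (hz : z ∈ X)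
    (j : Fin n) (e : Fin n → ℂ) :
    fderivWithin ℝ (wdz X u j) X z e =
      (1 / 2 : ℂ) * (fderivWithin ℝ (fderivWithin ℝ u X) X z e (Pi.single j 1) -
        Complex.I * fderivWithin ℝ (fderivWithin ℝ u X) X z e (Pi.single j Complex.I)) := by
  have h := (differentiableOn_fderivWithin hX hu z hz).hasFDerivWithinAt
  have h1 := h.clm_apply (hasFDerivWithinAt_const (Pi.single j (1 : ℂ)) z X)
  have h2 := h.clm_apply (hasFDerivWithinAt_const (Pi.single j Complex.I) z X)
  have h3 := (h1.sub (h2.const_mul Complex.I)).const_mul (1 / 2 : ℂ)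
  have h4 := h3.fderivWithin (hX.uniqueDiffWithinAt hz)
  change fderivWithin ℝ (wdz X u j) X z = _ at h4
  rw [h4]
  simp

theorem fderivWithin_wdzbar (hX : IsOpen X) (hu : ContDiffOn ℝ (⊤ : ℕ∞) u X) (hz : z ∈ X)
    (j : Fin n) (e : Fin n → ℂ) :
    fderivWithin ℝ (wdzbar X u j) X z e =
      (1 / 2 : ℂ) * (fderivWithin ℝ (fderivWithin ℝ u X) X z e (Pi.single j 1) +
        Complex.I * fderivWithin ℝ (fderivWithin ℝ u X) X z e (Pi.single j Complex.I)) := by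
  have h := (differentiableOn_fderivWithin hX hu z hz).hasFDerivWithinAt
  have h1 := h.clm_apply (hasFDerivWithinAt_const (Pi.single j (1 : ℂ)) z X)
  have h2 := h.clm_apply (hasFDerivWithinAt_const (Pi.single j Complex.I) z X)
  have h3 := (h1.add (h2.const_mul Complex.I)).const_mul (1 / 2 : ℂ)
  have h4 := h3.fderivWithin (hX.uniqueDiffWithinAt hz)
  change fderivWithin ℝ (wdzbar X u j) X z = _ at h4
  rw [h4]
  simp [mul_add]

/-- The Wirtinger derivatives of a smooth function on an open set commute. -/
theorem wdz_wdzbar_comm (hX : IsOpen X) (hu : ContDiffOn ℝ (⊤ : ℕ∞) u X) (hz : z ∈ X)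
    (j k : Fin n) :
    wdz X (wdzbar X u k) j z = wdzbar X (wdz X u j) k z := by
  have hsymm : IsSymmSndFDerivWithinAt ℝ u X z :=
    (hu z hz).isSymmSndFDerivWithinAt (by
      rw [minSmoothness_of_isRCLikeNormedField]
      exact WithTop.coe_le_coe.2 (le_top : (2 : ℕ∞) ≤ ⊤)) hX.uniqueDiffOn
      (subset_closure (by rwa [hX.interior_eq])) hz
  rw [wdz, wdzbar]
  simp only [fderivWithin_wdz hX hu hz, fderivWithin_wdzbar hX hu hz]
  rw [hsymm.eq (Pi.single k 1) (Pi.single j 1), hsymm.eq (Pi.single k 1) (Pi.single j Complex.I),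
    hsymm.eq (Pi.single k Complex.I) (Pi.single j 1),
    hsymm.eq (Pi.single k Complex.I) (Pi.single j Complex.I)]
  ring

theorem ddbar_sub (hX : IsOpen X) (hu : ContDiffOn ℝ (⊤ : ℕ∞) u X)
    (hv : ContDiffOn ℝ (⊤ : ℕ∞) v X) (hz : z ∈ X) (j k : Fin n) :
    ddbar X (fun y => u y - v y) j k z = ddbar X u j k z - ddbar X v j k z := by
  have hu' := hu.differentiableOn (by simp)
  have hv' := hv.differentiableOn (by simp)
  rw [ddbar, wdz_congr (fun y hy => wdzbar_sub hX hy (hu' y hy) (hv' y hy) k) hz,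
    wdz_sub hX hz (differentiableOn_wdzbar hX hu k z hz) (differentiableOn_wdzbar hX hv k z hz)]
  rfl

theorem suppIn_sub_subset :
    suppIn X (fun y => u y - v y) ⊆ suppIn X u ∪ suppIn X v := by
  rw [suppIn, suppIn, suppIn, ← Set.inter_union_distrib_left, ← closure_union]
  refine Set.inter_subset_inter_right _ (closure_mono ?_)
  rintro y ⟨hy, hne⟩
  by_cases h : u y = 0
  · exact Or.inr ⟨hy, fun h' => hne (by simp [h, h'])⟩
  · exact Or.inl ⟨hy, h⟩

end Wirtinger

/-- Under the vanishing of the cohomology groups with support in `cl Ω`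
(hypotheses (i), (ii), (iii)), every d-closed smooth (1,1)-form `g` on `X` with support in
`cl Ω` can be written `g = ∂∂̄v` with `v` smooth, supported in `cl Ω`. -/
theorem stmt6 {n : ℕ} (hn : 0 < n) (X : Set (Fin n → ℂ)) (hX : IsOpen X)
    (Ω : Set (Fin n → ℂ)) (hΩ : IsOpen Ω) (hΩX : Ω ⊆ X)
    (hProper : (X \ closure Ω).Nonempty)
    (hi : ∀ f : Fin n → Fin n → (Fin n → ℂ) → ℂ, Smooth11 X f → DClosed11 X f →
      supp11 X f ⊆ X ∩ closure Ω →
      ∃ a b : Fin n → (Fin n → ℂ) → ℂ,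
        (∀ j, ContDiffOn ℝ (⊤ : ℕ∞) (a j) X) ∧ (∀ k, ContDiffOn ℝ (⊤ : ℕ∞) (b k) X) ∧
        IsDOf X a b f ∧ supp1 X a b ⊆ X ∩ closure Ω)
    (hii : ∀ b : Fin n → (Fin n → ℂ) → ℂ, (∀ k, ContDiffOn ℝ (⊤ : ℕ∞) (b k) X) →
      DbarClosed01 X b → (⋃ k, suppIn X (b k)) ⊆ X ∩ closure Ω →
      ∃ w : (Fin n → ℂ) → ℂ, ContDiffOn ℝ (⊤ : ℕ∞) w X ∧ suppIn X w ⊆ X ∩ closure Ω ∧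
        ∀ k, ∀ z ∈ X, b k z = wdzbar X w k z)
    (hiii : ∀ a : Fin n → (Fin n → ℂ) → ℂ, (∀ j, ContDiffOn ℝ (⊤ : ℕ∞) (a j) X) →
      DClosed10 X a → (⋃ j, suppIn X (a j)) ⊆ X ∩ closure Ω →
      ∃ w : (Fin n → ℂ) → ℂ, ContDiffOn ℝ (⊤ : ℕ∞) w X ∧ suppIn X w ⊆ X ∩ closure Ω ∧
        ∀ j, ∀ z ∈ X, a j z = wdz X w j z) :
    ∀ g : Fin n → Fin n → (Fin n → ℂ) → ℂ, Smooth11 X g → DClosed11 X g →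
      supp11 X g ⊆ X ∩ closure Ω →
      ∃ v : (Fin n → ℂ) → ℂ, ContDiffOn ℝ (⊤ : ℕ∞) v X ∧ suppIn X v ⊆ X ∩ closure Ω ∧
        ∀ j k, ∀ z ∈ X, g j k z = ddbar X v j k z := by
  intro g hg hgd hgs
  obtain ⟨a, b, ha, hb, ⟨hgab, hacl, hbcl⟩, hs⟩ := hi g hg hgd hgs
  obtain ⟨w, hw, hws, hbw⟩ := hii b hb hbcl (Set.subset_union_right.trans hs)
  obtain ⟨u, hu, hus, hau⟩ := hiii a ha hacl (Set.subset_union_left.trans hs)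
  refine ⟨fun y => w y - u y, hw.sub hu, suppIn_sub_subset.trans (Set.union_subset hws hus),
    fun j k z hz => ?_⟩
  rw [hgab j k z hz, ddbar_sub hX hw hu hz, wdz_congr (hbw k) hz, wdzbar_congr (hau j) hz,
    ddbar, ddbar, wdz_wdzbar_comm hX hu hz]
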